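/- (Theorem 2.4) Let ρ be an arbitrary tripartite qudit state on ℂ^d ⊗ ℂ^d ⊗ ℂ^d (pure or mixed). Then the sum of the three isotropic strengths of its two-party reduced states satisfies s_iso^{AB} + s_iso^{AC} + s_iso^{BC} ≤ d − 1. -/

import Mathlib

open Matrix ComplexOrder

namespace SpinCorr3

variable {d : ℕ}

/-- Tensor (Kronecker) product of three `d × d` matrices, acting on `ℂ^d ⊗ ℂ^d ⊗ ℂ^d`. -/
noncomputable def kron3 (A B C : Matrix (Fin d) (Fin d) ℂ) :
    Matrix (Fin d × Fin d × Fin d) (Fin d × Fin d × Fin d) ℂ :=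
  Matrix.of fun p q => A p.1 q.1 * B p.2.1 q.2.1 * C p.2.2 q.2.2

variable (lam : Fin (d ^ 2 - 1) → Matrix (Fin d) (Fin d) ℂ)
variable (ρ : Matrix (Fin d × Fin d × Fin d) (Fin d × Fin d × Fin d) ℂ)

/-- `‖a‖²`, the squared Euclidean norm of the Bloch vector of party A. -/
noncomputable def aSq : ℝ := ∑ i, ‖(ρ * kron3 (lam i) 1 1).trace‖ ^ 2

/-- `‖b‖²`. -/
noncomputable def bSq : ℝ := ∑ j, ‖(ρ * kron3 1 (lam j) 1).trace‖ ^ 2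

/-- `‖c‖²`. -/
noncomputable def cSq : ℝ := ∑ l, ‖(ρ * kron3 1 1 (lam l)).trace‖ ^ 2

/-- `‖R^{AB}‖²`, squared Frobenius norm of the spin correlation matrix of parties A,B. -/
noncomputable def RABsq : ℝ := ∑ i, ∑ j, ‖(ρ * kron3 (lam i) (lam j) 1).trace‖ ^ 2

/-- `‖R^{BC}‖²`. -/
noncomputable def RBCsq : ℝ := ∑ j, ∑ l, ‖(ρ * kron3 1 (lam j) (lam l)).trace‖ ^ 2

/-- `‖R^{AC}‖²`. -/
noncomputable def RACsq : ℝ := ∑ i, ∑ l, ‖(ρ * kron3 (lam i) 1 (lam l)).trace‖ ^ 2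

/-- `‖R^{ABC}‖²`, squared Euclidean norm of the tripartite correlation tensor. -/
noncomputable def RABCsq : ℝ := ∑ i, ∑ j, ∑ l, ‖(ρ * kron3 (lam i) (lam j) (lam l)).trace‖ ^ 2

/-- Isotropic strength `s_iso^{AB} = ‖R^{AB}‖²/(d²-1)`. -/
noncomputable def sAB : ℝ := RABsq lam ρ / ((d : ℝ) ^ 2 - 1)

/-- `s_iso^{BC}`. -/
noncomputable def sBC : ℝ := RBCsq lam ρ / ((d : ℝ) ^ 2 - 1)

/-- `s_iso^{AC}`. -/
noncomputable def sAC : ℝ := RACsq lam ρ / ((d : ℝ) ^ 2 - 1)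

/-- A family of matrices together with the identity. -/
noncomputable def withOne (o : Option (Fin (d ^ 2 - 1))) : Matrix (Fin d) (Fin d) ℂ :=
  o.elim 1 lam

/-- The expectation value of `A ⊗ B ⊗ C` in the (unnormalized) pure state `ψ`. -/
noncomputable def pureExp (ψ : Fin d → Fin d → Fin d → ℂ) (A B C : Matrix (Fin d) (Fin d) ℂ) : ℂ :=
  ∑ a, ∑ a', ∑ b, ∑ b', ∑ c, ∑ c', ψ a b c * star (ψ a' b' c') * A a' a * B b' b * C c' c

/-- The squared norm of a pure state. -/
noncomputable def normSq3 (ψ : Fin d → Fin d → Fin d → ℂ) : ℝ :=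
  ∑ a, ∑ b, ∑ c, ‖ψ a b c‖ ^ 2

section Completeness

variable {lam}

lemma trace_withOne_mul
    (htr0 : ∀ i, (lam i).trace = 0)
    (horth : ∀ i j, (lam i * lam j).trace = if i = j then (d : ℂ) else 0)
    (i j : Option (Fin (d ^ 2 - 1))) :
    (withOne lam i * withOne lam j).trace = if i = j then (d : ℂ) else 0 := by
  cases i <;> cases j <;> simp [withOne, htr0, horth]

lemma withOne_isHermitian (hherm : ∀ i, (lam i).IsHermitian) (i : Option (Fin (d ^ 2 - 1))) :
    (withOne lam i).IsHermitian := by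
  cases i
  · exact Matrix.isHermitian_one
  · exact hherm _

/-- Parseval's identity for the orthogonal basis consisting of the identity and `lam`. -/
lemma sum_norm_sq_withOne (hd : 2 ≤ d)
    (hherm : ∀ i, (lam i).IsHermitian)
    (htr0 : ∀ i, (lam i).trace = 0)
    (horth : ∀ i j, (lam i * lam j).trace = if i = j then (d : ℂ) else 0)
    (f : Fin d → Fin d → ℂ) :
    ∑ i, ‖∑ a, ∑ a', f a a' * withOne lam i a' a‖ ^ 2 = d * ∑ a, ∑ a', ‖f a a'‖ ^ 2 := by
  have hd0 : (d : ℂ) ≠ 0 := by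
    have : d ≠ 0 := by omega
    exact_mod_cast this
  let U : Matrix (Option (Fin (d ^ 2 - 1))) (Fin d × Fin d) ℂ :=
    Matrix.of fun i p => withOne lam i p.2 p.1
  have hU : U * Uᴴ = (d : ℂ) • 1 := by
    ext i j
    have h := trace_withOne_mul htr0 horth i j
    rw [Matrix.smul_apply, Matrix.one_apply, smul_eq_mul, mul_ite, mul_one, mul_zero, ← h,
      Matrix.trace, Matrix.mul_apply, Fintype.sum_prod_type, Finset.sum_comm]
    refine Finset.sum_congr rfl fun a _ => ?_
    rw [Matrix.diag_apply, Matrix.mul_apply]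
    refine Finset.sum_congr rfl fun b _ => ?_
    simp only [U, Matrix.of_apply, Matrix.conjTranspose_apply]
    rw [(withOne_isHermitian hherm j).apply]
  have hcard : Fintype.card (Option (Fin (d ^ 2 - 1))) = Fintype.card (Fin d × Fin d) := by
    have : 0 < d ^ 2 := by positivity
    simp only [Fintype.card_option, Fintype.card_fin, Fintype.card_prod]
    rw [← pow_two]
    omega
  have h1 : U * ((d : ℂ)⁻¹ • Uᴴ) = 1 := by
    rw [Matrix.mul_smul, hU, smul_smul, inv_mul_cancel₀ hd0, one_smul]
  have h2 : ((d : ℂ)⁻¹ • Uᴴ) * U = 1 :=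
    (Matrix.mul_eq_one_comm_of_equiv (Fintype.equivOfCardEq hcard)).mp h1
  have h3 : Uᴴ * U = (d : ℂ) • 1 := by
    rw [← h2, Matrix.smul_mul, smul_smul, mul_inv_cancel₀ hd0, one_smul]
  let g : Fin d × Fin d → ℂ := fun p => f p.1 p.2
  have hg : star (U *ᵥ g) ⬝ᵥ (U *ᵥ g) = d * (star g ⬝ᵥ g) := by
    rw [Matrix.star_mulVec, ← Matrix.dotProduct_mulVec, Matrix.mulVec_mulVec, h3,
      Matrix.smul_mulVec, Matrix.one_mulVec, dotProduct_smul, smul_eq_mul]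
  have hL : ∀ i, (U *ᵥ g) i = ∑ a, ∑ a', f a a' * withOne lam i a' a := fun i => by
    simp only [Matrix.mulVec, dotProduct, Fintype.sum_prod_type, U, g, Matrix.of_apply, mul_comm]
  simp only [dotProduct, Pi.star_apply, hL, Fintype.sum_prod_type, g, RCLike.star_def,
    Complex.conj_mul'] at hg
  exact_mod_cast hg

lemma sum_sum_norm_sq_withOne (hd : 2 ≤ d)
    (hherm : ∀ i, (lam i).IsHermitian)
    (htr0 : ∀ i, (lam i).trace = 0)
    (horth : ∀ i j, (lam i * lam j).trace = if i = j then (d : ℂ) else 0)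
    (f : Fin d → Fin d → Fin d → Fin d → ℂ) :
    ∑ i, ∑ j, ‖∑ a, ∑ a', ∑ b, ∑ b', f a a' b b' * withOne lam i a' a * withOne lam j b' b‖ ^ 2
      = d ^ 2 * ∑ a, ∑ a', ∑ b, ∑ b', ‖f a a' b b'‖ ^ 2 := by
  have h : ∀ i j, ∑ a, ∑ a', ∑ b, ∑ b', f a a' b b' * withOne lam i a' a * withOne lam j b' b
      = ∑ a, ∑ a', (∑ b, ∑ b', f a a' b b' * withOne lam j b' b) * withOne lam i a' a := by
    intro i j
    simp only [Finset.sum_mul]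
    simp only [mul_right_comm]
  simp only [h]
  rw [Finset.sum_comm]
  simp only [sum_norm_sq_withOne hd hherm htr0 horth]
  rw [← Finset.mul_sum, Finset.sum_comm, pow_two (d : ℝ), mul_assoc]
  congr 1
  rw [Finset.mul_sum]
  refine Finset.sum_congr rfl fun a _ => ?_
  rw [Finset.sum_comm, Finset.mul_sum]
  exact Finset.sum_congr rfl fun a' _ => sum_norm_sq_withOne hd hherm htr0 horth _

end Completeness

section Gram

variable {m n : Type*} [Fintype n]

lemma norm_sq_mul_conjTranspose_apply_le (X : Matrix m n ℂ) (i j : m) :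
    ‖(X * Xᴴ) i j‖ ^ 2 ≤ (∑ k, ‖X i k‖ ^ 2) * ∑ k, ‖X j k‖ ^ 2 := by
  calc ‖(X * Xᴴ) i j‖ ^ 2 ≤ (∑ k, ‖X i k‖ * ‖X j k‖) ^ 2 := by
        gcongr
        rw [Matrix.mul_apply]
        refine (norm_sum_le _ _).trans_eq (Finset.sum_congr rfl fun k _ => ?_)
        rw [norm_mul, Matrix.conjTranspose_apply, norm_star]
    _ ≤ _ := Finset.sum_mul_sq_le_sq_mul_sq _ _ _

variable [Fintype m]

lemma sum_norm_sq_eq_trace (M : Matrix m n ℂ) :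
    ((∑ i, ∑ j, ‖M i j‖ ^ 2 : ℝ) : ℂ) = (M * Mᴴ).trace := by
  simp [Matrix.trace, Matrix.mul_apply, Complex.mul_conj']

/-- Both reduced states of a bipartite pure state have the same purity. -/
lemma sum_norm_sq_mul_conjTranspose (X : Matrix m n ℂ) :
    ∑ i, ∑ j, ‖(X * Xᴴ) i j‖ ^ 2 = ∑ i, ∑ j, ‖(Xᴴ * X) i j‖ ^ 2 := by
  have h : ((∑ i, ∑ j, ‖(X * Xᴴ) i j‖ ^ 2 : ℝ) : ℂ) = ((∑ i, ∑ j, ‖(Xᴴ * X) i j‖ ^ 2 : ℝ) : ℂ) := by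
    rw [sum_norm_sq_eq_trace, sum_norm_sq_eq_trace]
    simp only [Matrix.conjTranspose_mul, Matrix.conjTranspose_conjTranspose]
    rw [Matrix.mul_assoc, Matrix.trace_mul_comm]
    simp only [Matrix.mul_assoc]
  exact_mod_cast h

lemma sum_norm_sq_mul_conjTranspose_le (X : Matrix m n ℂ) :
    ∑ i, ∑ j, ‖(X * Xᴴ) i j‖ ^ 2 ≤ (∑ i, ∑ k, ‖X i k‖ ^ 2) ^ 2 := by
  rw [pow_two, Finset.sum_mul_sum]
  gcongr
  exact norm_sq_mul_conjTranspose_apply_le X _ _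

open scoped MatrixOrder Matrix.Norms.L2Operator in
lemma exists_eq_conjTranspose_mul_self {ρ : Matrix m m ℂ} (hρ : ρ.PosSemidef) :
    ∃ B : Matrix m m ℂ, ρ = Bᴴ * B := by
  classical
  exact CStarAlgebra.nonneg_iff_eq_star_mul_self.mp hρ.nonneg

/-- A bound on the correlations of pure states extends to mixed states. -/
lemma sum_norm_sq_trace_mul_le {κ : Type*} [Fintype κ] (O : κ → Matrix m m ℂ) {K : ℝ}
    (hK : 0 ≤ K)
    (h : ∀ v : m → ℂ,
      ∑ x, ‖(vecMulVec v (star v) * O x).trace‖ ^ 2 ≤ K * (∑ p, ‖v p‖ ^ 2) ^ 2)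
    {ρ : Matrix m m ℂ} (hρ : ρ.PosSemidef) (htr : ρ.trace = 1) :
    ∑ x, ‖(ρ * O x).trace‖ ^ 2 ≤ K := by
  classical
  obtain ⟨B, rfl⟩ := exists_eq_conjTranspose_mul_self hρ
  let v : m → m → ℂ := fun k => star (B k)
  have hdec : Bᴴ * B = ∑ k, vecMulVec (v k) (star (v k)) := by
    ext p q
    simp [Matrix.mul_apply, Matrix.sum_apply, vecMulVec_apply, v]
  have hN : ∑ k, ∑ p, ‖v k p‖ ^ 2 = 1 := by
    have h1 : ((∑ k, ∑ p, ‖v k p‖ ^ 2 : ℝ) : ℂ) = 1 := by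
      rw [← htr, Matrix.trace_mul_comm, ← sum_norm_sq_eq_trace]
      simp [v]
    exact_mod_cast h1
  let T : m → EuclideanSpace ℂ κ := fun k =>
    WithLp.toLp 2 fun x => (vecMulVec (v k) (star (v k)) * O x).trace
  have hT : ∀ k, ‖T k‖ ≤ √K * ∑ p, ‖v k p‖ ^ 2 := fun k => by
    have hnn : 0 ≤ ∑ p, ‖v k p‖ ^ 2 := by positivity
    refine abs_le_of_sq_le_sq' ?_ (by positivity) |>.2
    rw [EuclideanSpace.norm_sq_eq, mul_pow, Real.sq_sqrt hK]
    exact h (v k)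
  have hsum : ‖∑ k, T k‖ ≤ √K := by
    refine (norm_sum_le _ _).trans ((Finset.sum_le_sum fun k _ => hT k).trans_eq ?_)
    rw [← Finset.mul_sum, hN, mul_one]
  have hfin : ∑ x, ‖((Bᴴ * B) * O x).trace‖ ^ 2 = ‖∑ k, T k‖ ^ 2 := by
    rw [EuclideanSpace.norm_sq_eq]
    refine Finset.sum_congr rfl fun x _ => ?_
    rw [hdec, Finset.sum_mul, Matrix.trace_sum]
    simp [T]
  rw [hfin, ← Real.sq_sqrt hK]
  gcongr

end Gram

section Pure

variable {lam}

lemma pureExp_rotate (ψ : Fin d → Fin d → Fin d → ℂ) (A B C : Matrix (Fin d) (Fin d) ℂ) :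
    pureExp ψ A B C = pureExp (fun b c a => ψ a b c) B C A := by
  simp only [pureExp, ← Fintype.sum_prod_type']
  refine Fintype.sum_equiv ⟨fun p => (p.2.2.1, p.2.2.2.1, p.2.2.2.2.1, p.2.2.2.2.2, p.1, p.2.1),
    fun p => (p.2.2.2.2.1, p.2.2.2.2.2, p.1, p.2.1, p.2.2.1, p.2.2.2.1),
    fun _ => rfl, fun _ => rfl⟩ _ _ fun p => ?_
  simp only [Equiv.coe_fn_mk]
  ring

lemma normSq3_rotate (ψ : Fin d → Fin d → Fin d → ℂ) :
    normSq3 (fun b c a => ψ a b c) = normSq3 ψ := by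
  simp only [normSq3, ← Fintype.sum_prod_type']
  exact Fintype.sum_equiv ⟨fun p => (p.2.2, p.1, p.2.1), fun p => (p.2.1, p.2.2, p.1),
    fun _ => rfl, fun _ => rfl⟩ _ _ fun p => rfl

lemma trace_vecMulVec_mul_kron3 (v : Fin d × Fin d × Fin d → ℂ)
    (A B C : Matrix (Fin d) (Fin d) ℂ) :
    (vecMulVec v (star v) * kron3 A B C).trace = pureExp (fun a b c => v (a, b, c)) A B C := by
  simp only [pureExp, Matrix.trace, Matrix.diag_apply, Matrix.mul_apply, vecMulVec_apply, kron3,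
    Matrix.of_apply, ← Fintype.sum_prod_type', Pi.star_apply]
  refine Fintype.sum_equiv ⟨fun p => (p.1.1, p.2.1, p.1.2.1, p.2.2.1, p.1.2.2, p.2.2.2),
    fun p => ((p.1, p.2.2.1, p.2.2.2.2.1), (p.2.1, p.2.2.2.1, p.2.2.2.2.2)),
    fun _ => rfl, fun _ => rfl⟩ _ _ fun p => ?_
  simp only [Equiv.coe_fn_mk]
  ring

/-- A tripartite pure state viewed as a bipartite one. -/
def flattenAB (ψ : Fin d → Fin d → Fin d → ℂ) : Matrix (Fin d × Fin d) (Fin d) ℂ :=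
  Matrix.of fun p c => ψ p.1 p.2 c

lemma pureExp_one_right (ψ : Fin d → Fin d → Fin d → ℂ) (A B : Matrix (Fin d) (Fin d) ℂ) :
    pureExp ψ A B 1 = ∑ a, ∑ a', ∑ b, ∑ b',
      (flattenAB ψ * (flattenAB ψ)ᴴ) (a, b) (a', b') * A a' a * B b' b := by
  simp [pureExp, Matrix.mul_apply, flattenAB, Matrix.one_apply, Finset.sum_mul]

lemma pureExp_one_one (ψ : Fin d → Fin d → Fin d → ℂ) (C : Matrix (Fin d) (Fin d) ℂ) :
    pureExp ψ 1 1 C = ∑ c, ∑ c', ((flattenAB ψ)ᴴ * flattenAB ψ) c' c * C c' c := by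
  rw [← pureExp_rotate (fun c a b => ψ a b c) C 1 1]
  simp only [pureExp, Matrix.mul_apply, flattenAB, Matrix.one_apply, Finset.sum_mul,
    Fintype.sum_prod_type]
  simp [mul_comm]

lemma pureExp_one_one_one (ψ : Fin d → Fin d → Fin d → ℂ) :
    pureExp ψ 1 1 1 = (normSq3 ψ : ℝ) := by
  rw [pureExp_one_right]
  simp [Matrix.mul_apply, flattenAB, Matrix.one_apply, normSq3, Complex.mul_conj']

lemma sum_norm_sq_pureExp_one_one (hd : 2 ≤ d)
    (hherm : ∀ i, (lam i).IsHermitian)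
    (htr0 : ∀ i, (lam i).trace = 0)
    (horth : ∀ i j, (lam i * lam j).trace = if i = j then (d : ℂ) else 0)
    (ψ : Fin d → Fin d → Fin d → ℂ) :
    normSq3 ψ ^ 2 + ∑ l, ‖pureExp ψ 1 1 (lam l)‖ ^ 2
      = d * ∑ p, ∑ q, ‖(flattenAB ψ * (flattenAB ψ)ᴴ) p q‖ ^ 2 := by
  have h := sum_norm_sq_withOne hd hherm htr0 horth
    fun c c' => ((flattenAB ψ)ᴴ * flattenAB ψ) c' c
  simp only [← pureExp_one_one, Fintype.sum_option] at h
  rw [sum_norm_sq_mul_conjTranspose, Finset.sum_comm, ← h]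
  simp [withOne, pureExp_one_one_one]

lemma sum_norm_sq_pureExp_one_right (hd : 2 ≤ d)
    (hherm : ∀ i, (lam i).IsHermitian)
    (htr0 : ∀ i, (lam i).trace = 0)
    (horth : ∀ i j, (lam i * lam j).trace = if i = j then (d : ℂ) else 0)
    (ψ : Fin d → Fin d → Fin d → ℂ) :
    normSq3 ψ ^ 2 + ∑ j, ‖pureExp ψ 1 (lam j) 1‖ ^ 2 + ∑ i, ‖pureExp ψ (lam i) 1 1‖ ^ 2
        + ∑ i, ∑ j, ‖pureExp ψ (lam i) (lam j) 1‖ ^ 2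
      = d ^ 2 * ∑ p, ∑ q, ‖(flattenAB ψ * (flattenAB ψ)ᴴ) p q‖ ^ 2 := by
  have h := sum_sum_norm_sq_withOne hd hherm htr0 horth
    fun a a' b b' => (flattenAB ψ * (flattenAB ψ)ᴴ) (a, b) (a', b')
  simp only [← pureExp_one_right, Fintype.sum_option] at h
  have hswap : ∑ p, ∑ q, ‖(flattenAB ψ * (flattenAB ψ)ᴴ) p q‖ ^ 2
      = ∑ a, ∑ a', ∑ b, ∑ b', ‖(flattenAB ψ * (flattenAB ψ)ᴴ) (a, b) (a', b')‖ ^ 2 := by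
    simp only [Fintype.sum_prod_type]
    exact Finset.sum_congr rfl fun a _ => Finset.sum_comm
  rw [hswap, ← h, Finset.sum_add_distrib]
  simp only [withOne, Option.elim, pureExp_one_one_one, Complex.norm_real, Real.norm_eq_abs,
    sq_abs]
  ring

lemma sum_norm_sq_flattenAB_le (ψ : Fin d → Fin d → Fin d → ℂ) :
    ∑ p, ∑ q, ‖(flattenAB ψ * (flattenAB ψ)ᴴ) p q‖ ^ 2 ≤ normSq3 ψ ^ 2 := by
  refine (sum_norm_sq_mul_conjTranspose_le _).trans_eq ?_
  simp [normSq3, flattenAB, Fintype.sum_prod_type]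

/-- The bound on the total two-party correlation strength of a pure state. -/
lemma sum_norm_sq_pureExp_le (hd : 2 ≤ d)
    (hherm : ∀ i, (lam i).IsHermitian)
    (htr0 : ∀ i, (lam i).trace = 0)
    (horth : ∀ i j, (lam i * lam j).trace = if i = j then (d : ℂ) else 0)
    (ψ : Fin d → Fin d → Fin d → ℂ) :
    ∑ i, ∑ j, ‖pureExp ψ (lam i) (lam j) 1‖ ^ 2 + ∑ i, ∑ j, ‖pureExp ψ (lam i) 1 (lam j)‖ ^ 2
        + ∑ i, ∑ j, ‖pureExp ψ 1 (lam i) (lam j)‖ ^ 2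
      ≤ ((d : ℝ) - 1) * ((d : ℝ) ^ 2 - 1) * normSq3 ψ ^ 2 := by
  have hC := sum_norm_sq_pureExp_one_one hd hherm htr0 horth ψ
  have hAB := sum_norm_sq_pureExp_one_right hd hherm htr0 horth ψ
  have hc := sum_norm_sq_flattenAB_le ψ
  have hA := sum_norm_sq_pureExp_one_one hd hherm htr0 horth fun b c a => ψ a b c
  have hBC := sum_norm_sq_pureExp_one_right hd hherm htr0 horth fun b c a => ψ a b c
  have ha := sum_norm_sq_flattenAB_le fun b c a => ψ a b c
  have hB := sum_norm_sq_pureExp_one_one hd hherm htr0 horth fun c a b => ψ a b c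
  have hCA := sum_norm_sq_pureExp_one_right hd hherm htr0 horth fun c a b => ψ a b c
  have hb := sum_norm_sq_flattenAB_le fun c a b => ψ a b c
  have hN : normSq3 (fun c a b => ψ a b c) = normSq3 ψ :=
    (normSq3_rotate fun c a b => ψ a b c).symm
  have hrot : ∀ A B C, pureExp (fun c a b => ψ a b c) C A B = pureExp ψ A B C :=
    fun A B C => pureExp_rotate (fun c a b => ψ a b c) C A B
  simp only [← pureExp_rotate ψ, normSq3_rotate ψ] at hA hBC ha
  simp only [hrot, hN] at hB hCA hb
  rw [Finset.sum_comm (f := fun i j => ‖pureExp ψ (lam j) 1 (lam i)‖ ^ 2)] at hCA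
  generalize (∑ p, ∑ q, ‖(flattenAB ψ * (flattenAB ψ)ᴴ) p q‖ ^ 2) = x at *
  generalize (∑ p, ∑ q, ‖(flattenAB (fun b c a => ψ a b c) *
    (flattenAB (fun b c a => ψ a b c))ᴴ) p q‖ ^ 2) = y at *
  generalize (∑ p, ∑ q, ‖(flattenAB (fun c a b => ψ a b c) *
    (flattenAB (fun c a b => ψ a b c))ᴴ) p q‖ ^ 2) = z at *
  have hd' : (2 : ℝ) ≤ d := by exact_mod_cast hd
  have hxyz : (d : ℝ) * (d - 2) * (x + y + z) ≤ d * (d - 2) * (3 * normSq3 ψ ^ 2) := by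
    have : (0 : ℝ) ≤ d * (d - 2) := mul_nonneg (by linarith) (by linarith)
    gcongr
    linarith
  have hlast : 0 ≤ ((d : ℝ) - 1) ^ 2 * (d - 2) * normSq3 ψ ^ 2 :=
    mul_nonneg (mul_nonneg (sq_nonneg _) (by linarith)) (sq_nonneg _)
  nlinarith

end Pure

/-- The local observables of the three two-party correlation matrices. -/
noncomputable def pairObservable :
    (Fin (d ^ 2 - 1) × Fin (d ^ 2 - 1)) ⊕ (Fin (d ^ 2 - 1) × Fin (d ^ 2 - 1)) ⊕
      (Fin (d ^ 2 - 1) × Fin (d ^ 2 - 1)) →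
      Matrix (Fin d × Fin d × Fin d) (Fin d × Fin d × Fin d) ℂ
  | .inl p => kron3 (lam p.1) (lam p.2) 1
  | .inr (.inl p) => kron3 (lam p.1) 1 (lam p.2)
  | .inr (.inr p) => kron3 1 (lam p.1) (lam p.2)

/-- Theorem 2.4: for an arbitrary (pure or mixed) tripartite qudit state, the sum of the
three isotropic strengths is at most `d - 1`. -/
theorem sum_isotropic_strengths_le (d : ℕ) (hd : 2 ≤ d)
    (lam : Fin (d ^ 2 - 1) → Matrix (Fin d) (Fin d) ℂ)
    (hherm : ∀ i, (lam i).IsHermitian)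
    (htr0 : ∀ i, (lam i).trace = 0)
    (horth : ∀ i j, (lam i * lam j).trace = if i = j then (d : ℂ) else 0)
    (ρ : Matrix (Fin d × Fin d × Fin d) (Fin d × Fin d × Fin d) ℂ)
    (hpsd : ρ.PosSemidef) (htr1 : ρ.trace = 1) :
    sAB lam ρ + sAC lam ρ + sBC lam ρ ≤ (d : ℝ) - 1 := by
  have hd' : (2 : ℝ) ≤ d := by exact_mod_cast hd
  have hpos : (0 : ℝ) < (d : ℝ) ^ 2 - 1 := by nlinarith
  have hmain := sum_norm_sq_trace_mul_le (pairObservable lam)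
    (K := ((d : ℝ) - 1) * ((d : ℝ) ^ 2 - 1)) (mul_nonneg (by linarith) hpos.le)
    (fun v => by
      have h := sum_norm_sq_pureExp_le hd hherm htr0 horth fun a b c => v (a, b, c)
      simpa [pairObservable, trace_vecMulVec_mul_kron3, Fintype.sum_prod_type, normSq3,
        add_assoc] using h)
    hpsd htr1
  simp only [pairObservable, Fintype.sum_sum_type, Fintype.sum_prod_type, ← add_assoc] at hmain
  rw [sAB, sAC, sBC, ← add_div, ← add_div, div_le_iff₀ hpos]
  exact hmain

end SpinCorr3
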